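/- arXiv:1207.0187 — 4 statements merged into one kernel-verified Lean document; each statement's English description precedes it below -/
import Mathlib

section
/- (Theorem 3.1, general form) Suppose the random vectors P_1 and P_2 are independent, and 0 < α_1 < α < 1. Let 𝓡_p ⊆ {1,…,m} be a rejection set that is a measurable function of P_1 and satisfies Pr(there exists j ∈ 𝓡_p with h_{1j} = 0) ≤ α_1, and let 𝓡_f(p_1, P_2) ⊆ S(p_1) be a rejection set, jointly measurable in (p_1, P_2), such that for every fixed p_1 ∈ [0,1]^m, Pr(there exists j ∈ 𝓡_f(p_1, P_2) with h_{2j} = 0) ≤ α − α_1. Then Pr(there exists j ∈ 𝓡_p(P_1) ∩ 𝓡_f(P_1, P_2) with (h_{1j}, h_{2j}) ≠ (1,1)) ≤ α; that is, the two-stage procedure controls the family-wise error rate at level α for the family of no-replicability nulls H_{NR,1},…,H_{NR,m}. -/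
open MeasureTheory ProbabilityTheory Finset

namespace Replicability

/-- A selection rule `S` is measurable: the preimage of each possible selected set is a
measurable subset of `[0,1]^m` (here all of `ℝ^m`). -/
def MeasRule (m : ℕ) (S : (Fin m → ℝ) → Finset (Fin m)) : Prop :=
  ∀ A : Finset (Fin m), MeasurableSet {p : Fin m → ℝ | S p = A}

/-- A valid selection rule: for any `p`, any `j ∈ S p`, and any `p'` agreeing with `p` in all
coordinates except possibly the `j`-th such that `j` is still selected under `p'`,
the selected set is unchanged. -/
def ValidRule (m : ℕ) (S : (Fin m → ℝ) → Finset (Fin m)) : Prop :=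
  ∀ p p' : Fin m → ℝ, ∀ j ∈ S p, (∀ i, i ≠ j → p' i = p i) → j ∈ S p' → S p' = S p

/-- Null p-values are superuniform: if `h j = false` (hypothesis `j` is a true null in this
study) then `Pr(P_j ≤ x) ≤ x` for all `x ∈ [0,1]`. -/
def Superuniform {Ω : Type*} [MeasurableSpace Ω] (μ : Measure Ω) {m : ℕ}
    (P : Ω → Fin m → ℝ) (h : Fin m → Bool) : Prop :=
  ∀ j : Fin m, h j = false → ∀ x : ℝ, 0 ≤ x → x ≤ 1 →
    μ {ω | P ω j ≤ x} ≤ ENNReal.ofReal x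

/-- p-values take values in `[0,1]`. -/
def InUnit {Ω : Type*} {m : ℕ} (P : Ω → Fin m → ℝ) : Prop :=
  ∀ ω j, P ω j ∈ Set.Icc (0 : ℝ) 1

/-- The (generalized) rejection set of Procedure 3.2: with selected set `𝓡₁ = S p₁` of size
`R₁`, primary thresholds `r * a / m` and follow-up thresholds `r * b R₁ / R₁`, let
`R₂ = max { r ≤ m : #{j ∈ 𝓡₁ : p₁ⱼ ≤ r a/m ∧ p₂ⱼ ≤ r (b R₁)/R₁} = r }`, and reject
`{j ∈ 𝓡₁ : p₁ⱼ ≤ R₂ a/m ∧ p₂ⱼ ≤ R₂ (b R₁)/R₁}`.  The basic Procedure 3.2 with parameters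
`(q₁, q)` is obtained with `a = q₁` and `b = fun _ => q - q₁`. -/
noncomputable def rejSet (m : ℕ) (S : (Fin m → ℝ) → Finset (Fin m))
    (a : ℝ) (b : ℕ → ℝ) (p1 p2 : Fin m → ℝ) : Finset (Fin m) :=
  let R1 := (S p1).card
  let R2 := sSup {r : ℕ | r ≤ m ∧
    ((S p1).filter
      (fun j => p1 j ≤ r * a / m ∧ p2 j ≤ r * b R1 / R1)).card = r}
  (S p1).filter (fun j => p1 j ≤ R2 * a / m ∧ p2 j ≤ R2 * b R1 / R1)

/-- False discovery proportion of rejection set `R` with respect to the set `I` of true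
nulls: `|R ∩ I| / max(|R|, 1)`. -/
noncomputable def FDP {m : ℕ} (I R : Finset (Fin m)) : ℝ :=
  ((R ∩ I).card : ℝ) / ((max R.card 1 : ℕ) : ℝ)

/-- The set `I_{ab} = {j : (h₁ⱼ, h₂ⱼ) = (a, b)}` (with `true` for 1, `false` for 0). -/
def Iset {m : ℕ} (h1 h2 : Fin m → Bool) (a b : Bool) : Finset (Fin m) :=
  Finset.univ.filter fun j => h1 j = a ∧ h2 j = b

/-- The indices of true no-replicability nulls: `I₀₀ ∪ I₀₁ ∪ I₁₀`. -/
def nullNR {m : ℕ} (h1 h2 : Fin m → Bool) : Finset (Fin m) :=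
  Finset.univ.filter fun j => h1 j = false ∨ h2 j = false

/-- Harmonic sum `∑_{i=1}^n 1/i`. -/
noncomputable def Hsum (n : ℕ) : ℝ := ∑ i ∈ Finset.range n, (1 : ℝ) / (i + 1)

/-- PRDS property of a random vector `Q` on a set `T` of coordinates: for every measurable
increasing set `D` and every `i ∈ T`, some monotone measurable `g` is a version of
`p ↦ Pr(Q ∈ D | Q_i = p)`. -/
def PRDS {Ω : Type*} [MeasurableSpace Ω] (μ : Measure Ω) {m : ℕ}
    (Q : Ω → Fin m → ℝ) (T : Set (Fin m)) : Prop :=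
  ∀ D : Set (Fin m → ℝ), MeasurableSet D →
    (∀ x ∈ D, ∀ y : Fin m → ℝ, x ≤ y → y ∈ D) →
    ∀ i ∈ T, ∃ g : ℝ → ℝ, Monotone g ∧ Measurable g ∧
      ∀ B : Set ℝ, MeasurableSet B →
        (μ ({ω | Q ω ∈ D} ∩ {ω | Q ω i ∈ B})).toReal =
          ∫ ω in {ω | Q ω i ∈ B}, g (Q ω i) ∂μ

end Replicability

namespace Replicability

/-- If a rule with values in the subsets of a finite type has measurable fibres, then the event
that its value satisfies a given property is measurable. -/
theorem measurableSet_finset_fibres {X ι : Type*} [MeasurableSpace X] [Finite ι]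
    {R : X → Finset ι} (hR : ∀ A, MeasurableSet {x | R x = A}) (p : Finset ι → Prop) :
    MeasurableSet {x | p (R x)} := by
  have : {x | p (R x)} = ⋃ A ∈ {A : Finset ι | p A}, {x | R x = A} := by
    ext x
    simp
  rw [this]
  exact MeasurableSet.biUnion (Set.to_countable _) fun A _ => hR A

/-- A bound on all sections of an event, in the first of two independent variables, bounds
the joint probability of the event. -/
theorem measure_preimage_prodMk_le_of_indepFun {Ω X Y : Type*} [MeasurableSpace Ω]
    [MeasurableSpace X] [MeasurableSpace Y] {μ : Measure Ω} [IsProbabilityMeasure μ]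
    {U : Ω → X} {V : Ω → Y} (hU : Measurable U) (hV : Measurable V) (hUV : IndepFun U V μ)
    {B : Set (X × Y)} (hB : MeasurableSet B) {c : ENNReal}
    (hc : ∀ x, μ {ω | (x, V ω) ∈ B} ≤ c) :
    μ {ω | (U ω, V ω) ∈ B} ≤ c := by
  have := Measure.isProbabilityMeasure_map (μ := μ) hU.aemeasurable
  have := Measure.isProbabilityMeasure_map (μ := μ) hV.aemeasurable
  calc μ {ω | (U ω, V ω) ∈ B} = μ.map (fun ω => (U ω, V ω)) B :=
        (Measure.map_apply (hU.prodMk hV) hB).symm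
    _ = ∫⁻ x, μ.map V (Prod.mk x ⁻¹' B) ∂μ.map U := by
        rw [(indepFun_iff_map_prod_eq_prod_map_map hU.aemeasurable hV.aemeasurable).1 hUV,
          Measure.prod_apply hB]
    _ ≤ ∫⁻ _, c ∂μ.map U := lintegral_mono fun x => by
        rw [Measure.map_apply hV (measurable_prodMk_left hB)]
        exact hc x
    _ = c := by simp

/-- Theorem 3.1, general form: the two-stage procedure controls the FWER at
level `α` for the family of no-replicability nulls. -/
theorem two_stage_FWER_control {Ω : Type*} [MeasurableSpace Ω]
    (μ : Measure Ω) [IsProbabilityMeasure μ]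
    (m : ℕ) (hm : 1 ≤ m)
    (P1 P2 : Ω → Fin m → ℝ) (hP1 : Measurable P1) (hP2 : Measurable P2)
    (hP1u : InUnit P1) (hP2u : InUnit P2)
    (h1 h2 : Fin m → Bool)
    (hsup1 : Superuniform μ P1 h1) (hsup2 : Superuniform μ P2 h2)
    (hIndep : IndepFun P1 P2 μ)
    (α1 α : ℝ) (hα1 : 0 < α1) (hα1α : α1 < α) (hα : α < 1)
    (S : (Fin m → ℝ) → Finset (Fin m)) (hS : MeasRule m S)
    -- the primary-study rejection set, a measurable function of `P1`,
    -- with FWER at most `α1` for the true nulls of the primary study: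
    (Rp : (Fin m → ℝ) → Finset (Fin m)) (hRp : MeasRule m Rp)
    (hRpFWER : μ {ω | ∃ j ∈ Rp (P1 ω), h1 j = false} ≤ ENNReal.ofReal α1)
    -- the follow-up rejection set, jointly measurable, contained in the selected set, and
    -- with conditional FWER at most `α - α1` for the true nulls of the follow-up study:
    (Rf : (Fin m → ℝ) → (Fin m → ℝ) → Finset (Fin m))
    (hRfMeas : ∀ A : Finset (Fin m),
      MeasurableSet {x : (Fin m → ℝ) × (Fin m → ℝ) | Rf x.1 x.2 = A})
    (hRfSel : ∀ p1 p2 : Fin m → ℝ, Rf p1 p2 ⊆ S p1)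
    (hRfFWER : ∀ p1 : Fin m → ℝ,
      μ {ω | ∃ j ∈ Rf p1 (P2 ω), h2 j = false} ≤ ENNReal.ofReal (α - α1)) :
    μ {ω | ∃ j ∈ Rp (P1 ω) ∩ Rf (P1 ω) (P2 ω), ¬(h1 j = true ∧ h2 j = true)}
      ≤ ENNReal.ofReal α := by
  have hf : μ {ω | ∃ j ∈ Rf (P1 ω) (P2 ω), h2 j = false} ≤ ENNReal.ofReal (α - α1) :=
    measure_preimage_prodMk_le_of_indepFun hP1 hP2 hIndep
      (measurableSet_finset_fibres hRfMeas fun A => ∃ j ∈ A, h2 j = false) hRfFWER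
  calc μ {ω | ∃ j ∈ Rp (P1 ω) ∩ Rf (P1 ω) (P2 ω), ¬(h1 j = true ∧ h2 j = true)}
      ≤ μ ({ω | ∃ j ∈ Rp (P1 ω), h1 j = false} ∪
          {ω | ∃ j ∈ Rf (P1 ω) (P2 ω), h2 j = false}) := by
        refine measure_mono ?_
        rintro ω ⟨j, hj, hne⟩
        rw [Finset.mem_inter] at hj
        rcases not_and_or.1 hne with h | h
        · exact Or.inl ⟨j, hj.1, Bool.eq_false_of_not_eq_true h⟩
        · exact Or.inr ⟨j, hj.2, Bool.eq_false_of_not_eq_true h⟩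
    _ ≤ ENNReal.ofReal α1 + ENNReal.ofReal (α - α1) :=
        (measure_union_le _ _).trans (add_le_add hRpFWER hf)
    _ = ENNReal.ofReal α := by
        rw [← ENNReal.ofReal_add hα1.le (sub_nonneg.2 hα1α.le), add_sub_cancel]

end Replicability
end

section
/- (Bonferroni instantiation of Procedure 3.1) Suppose the random vectors P_1 and P_2 are independent and 0 < α_1 < α < 1. Let S be any selection rule and 𝓡_1 = S(P_1). The procedure that rejects H_{NR,j} exactly when j ∈ 𝓡_1, P_{1j} ≤ α_1/m, and P_{2j} ≤ (α − α_1)/|𝓡_1| satisfies Pr(at least one j with (h_{1j}, h_{2j}) ≠ (1,1) is rejected) ≤ α. -/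
open MeasureTheory ProbabilityTheory Finset

namespace Replicability

/-- Bonferroni's inequality: testing each true null of `A` at level `c / |A|` gives at least one
rejection with probability at most `c`. -/
theorem Superuniform.measure_exists_le_div_card {Ω : Type*} [MeasurableSpace Ω] {μ : Measure Ω}
    {m : ℕ} {P : Ω → Fin m → ℝ} {h : Fin m → Bool} (hP : Superuniform μ P h)
    {c : ℝ} (hc0 : 0 ≤ c) (hc1 : c ≤ 1) (A : Finset (Fin m)) :
    μ {ω | ∃ j ∈ A, h j = false ∧ P ω j ≤ c / (A.card : ℝ)} ≤ ENNReal.ofReal c := by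
  have hsub : {ω | ∃ j ∈ A, h j = false ∧ P ω j ≤ c / (A.card : ℝ)} ⊆
      ⋃ j ∈ A, {ω | h j = false ∧ P ω j ≤ c / (A.card : ℝ)} := by
    rintro ω ⟨j, hj, hω⟩
    exact Set.mem_biUnion hj hω
  have hterm : ∀ j ∈ A, μ {ω | h j = false ∧ P ω j ≤ c / (A.card : ℝ)} ≤
      ENNReal.ofReal (c / (A.card : ℝ)) := by
    intro j hj
    by_cases hh : h j = false
    · have hA : (1 : ℝ) ≤ A.card := by exact_mod_cast Finset.card_pos.mpr ⟨j, hj⟩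
      simpa [hh] using hP j hh _ (by positivity) ((div_le_self hc0 hA).trans hc1)
    · simp [hh]
  calc _ ≤ ∑ j ∈ A, μ {ω | h j = false ∧ P ω j ≤ c / (A.card : ℝ)} :=
        (measure_mono hsub).trans (measure_biUnion_finset_le A _)
    _ ≤ ∑ _j ∈ A, ENNReal.ofReal (c / (A.card : ℝ)) := Finset.sum_le_sum hterm
    _ = ENNReal.ofReal (A.card * (c / (A.card : ℝ))) := by
        rw [Finset.sum_const, ← ENNReal.ofReal_nsmul, nsmul_eq_mul]
    _ ≤ ENNReal.ofReal c := by
        rcases A.eq_empty_or_nonempty with rfl | hA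
        · simp
        · rw [mul_div_cancel₀ _ (by exact_mod_cast hA.card_ne_zero)]

/-- Conditional Bonferroni: if the selected set is independent of the p-values, testing each
selected true null at level `c / |selected set|` gives at least one rejection with probability at
most `c`. -/
theorem Superuniform.measure_exists_selected_le {Ω : Type*} [MeasurableSpace Ω] {μ : Measure Ω}
    [IsProbabilityMeasure μ] {m : ℕ} {P Q : Ω → Fin m → ℝ} {h : Fin m → Bool}
    (hP : Superuniform μ P h) (hQm : Measurable Q) (hQP : IndepFun Q P μ)
    {S : (Fin m → ℝ) → Finset (Fin m)} (hS : MeasRule m S)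
    {c : ℝ} (hc0 : 0 ≤ c) (hc1 : c ≤ 1) :
    μ {ω | ∃ j ∈ S (Q ω), h j = false ∧ P ω j ≤ c / ((S (Q ω)).card : ℝ)} ≤
      ENNReal.ofReal c := by
  let T : Finset (Fin m) → Set (Fin m → ℝ) :=
    fun A => {p | ∃ j ∈ A, h j = false ∧ p j ≤ c / (A.card : ℝ)}
  have hT : ∀ A, MeasurableSet (T A) := by
    intro A
    have : T A = ⋃ j ∈ A, {p | h j = false ∧ p j ≤ c / (A.card : ℝ)} := by
      ext p
      simp [T, and_left_comm]
    rw [this]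
    exact A.measurableSet_biUnion fun j _ => (MeasurableSet.const _).inter
      (measurableSet_le (measurable_pi_apply j) measurable_const)
  have hsub : {ω | ∃ j ∈ S (Q ω), h j = false ∧ P ω j ≤ c / ((S (Q ω)).card : ℝ)} ⊆
      ⋃ A ∈ (Finset.univ : Finset (Finset (Fin m))), Q ⁻¹' {p | S p = A} ∩ P ⁻¹' T A := by
    intro ω hω
    exact Set.mem_biUnion (Finset.mem_univ (S (Q ω))) ⟨rfl, hω⟩
  have hsum : ∑ A : Finset (Fin m), μ (Q ⁻¹' {p | S p = A}) = 1 := by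
    rw [← measure_biUnion_finset _ fun A _ => hQm (hS A)]
    · rw [← measure_univ (μ := μ)]
      congr 1
      ext ω
      simp
    · intro A _ B _ hAB
      exact Set.disjoint_left.mpr fun ω hA hB => hAB (hA.symm.trans hB)
  calc _ ≤ ∑ A : Finset (Fin m), μ (Q ⁻¹' {p | S p = A} ∩ P ⁻¹' T A) :=
        (measure_mono hsub).trans (measure_biUnion_finset_le _ _)
    _ ≤ ∑ A : Finset (Fin m), μ (Q ⁻¹' {p | S p = A}) * ENNReal.ofReal c := by
        refine Finset.sum_le_sum fun A _ => ?_
        rw [hQP.measure_inter_preimage_eq_mul _ _ (hS A) (hT A)]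
        gcongr
        exact hP.measure_exists_le_div_card hc0 hc1 A
    _ = ENNReal.ofReal c := by rw [← Finset.sum_mul, hsum, one_mul]

/-- Bonferroni instantiation of Procedure 3.1: rejecting `H_{NR,j}` exactly
when `j` is selected, `P_{1j} ≤ α₁/m`, and `P_{2j} ≤ (α-α₁)/|𝓡₁|` controls the FWER for the
no-replicability nulls at level `α`. -/
theorem bonferroni_two_stage_FWER_control {Ω : Type*} [MeasurableSpace Ω]
    (μ : Measure Ω) [IsProbabilityMeasure μ]
    (m : ℕ) (hm : 1 ≤ m)
    (P1 P2 : Ω → Fin m → ℝ) (hP1 : Measurable P1) (hP2 : Measurable P2)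
    (hP1u : InUnit P1) (hP2u : InUnit P2)
    (h1 h2 : Fin m → Bool)
    (hsup1 : Superuniform μ P1 h1) (hsup2 : Superuniform μ P2 h2)
    (hIndep : IndepFun P1 P2 μ)
    (α1 α : ℝ) (hα1 : 0 < α1) (hα1α : α1 < α) (hα : α < 1)
    (S : (Fin m → ℝ) → Finset (Fin m)) (hS : MeasRule m S) :
    μ {ω | ∃ j ∈ S (P1 ω),
        P1 ω j ≤ α1 / m ∧ P2 ω j ≤ (α - α1) / ((S (P1 ω)).card : ℝ) ∧
        ¬(h1 j = true ∧ h2 j = true)}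
      ≤ ENNReal.ofReal α := by
  have hsub : {ω | ∃ j ∈ S (P1 ω),
        P1 ω j ≤ α1 / m ∧ P2 ω j ≤ (α - α1) / ((S (P1 ω)).card : ℝ) ∧
        ¬(h1 j = true ∧ h2 j = true)} ⊆
      {ω | ∃ j ∈ Finset.univ, h1 j = false ∧
        P1 ω j ≤ α1 / ((Finset.univ : Finset (Fin m)).card : ℝ)} ∪
      {ω | ∃ j ∈ S (P1 ω), h2 j = false ∧ P2 ω j ≤ (α - α1) / ((S (P1 ω)).card : ℝ)} := by
    rintro ω ⟨j, hj, hj1, hj2, hnull⟩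
    cases hh : h1 j
    · exact Or.inl ⟨j, Finset.mem_univ j, hh, by simpa using hj1⟩
    · exact Or.inr ⟨j, hj, by simpa [hh] using hnull, hj2⟩
  calc _ ≤ _ := (measure_mono hsub).trans (measure_union_le _ _)
    _ ≤ ENNReal.ofReal α1 + ENNReal.ofReal (α - α1) := add_le_add
        (hsup1.measure_exists_le_div_card hα1.le (by linarith) Finset.univ)
        (hsup2.measure_exists_selected_le hP1 hIndep hS (by linarith) (by linarith))
    _ = ENNReal.ofReal α := by
        rw [← ENNReal.ofReal_add hα1.le (by linarith), add_sub_cancel]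

end Replicability
end

section
/- (Theorem 3.3, item 1) Suppose the random vectors P_1 and P_2 are independent (with arbitrary dependence among the coordinates of P_1), the follow-up vector P_2 is PRDS on {j : h_{2j} = 0}, and S is a valid selection rule. Consider Procedure 3.2 with parameters (q_1, q) modified by replacing q_1 with q̃_1 = q_1 / (∑_{i=1}^m 1/i) in the thresholds r q_1/m and R_2 q_1/m only (the follow-up thresholds keep q − q_1). Then the modified procedure satisfies FDR ≤ q for the family of no-replicability nulls H_{NR,1},…,H_{NR,m}. -/
open MeasureTheory ProbabilityTheory Finset

namespace Replicability

/-- The number of selected indices whose two p-values pass the level-`r` thresholds. -/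
noncomputable def passCount {m : ℕ} (A : Finset (Fin m)) (s t : ℝ) (p1 p2 : Fin m → ℝ)
    (r : ℕ) : ℕ :=
  (A.filter fun j => p1 j ≤ r * s ∧ p2 j ≤ r * t).card

/-- The step-up index: the largest `r ≤ m` such that at least `r` selected indices pass the
level-`r` thresholds. -/
noncomputable def stepUpIndex {m : ℕ} (A : Finset (Fin m)) (s t : ℝ) (p1 p2 : Fin m → ℝ) : ℕ :=
  Nat.findGreatest (fun r => r ≤ passCount A s t p1 p2 r) m

section StepUp

variable {m : ℕ} {A : Finset (Fin m)} {s t : ℝ} {p1 p2 : Fin m → ℝ}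

lemma passCount_le (r : ℕ) : passCount A s t p1 p2 r ≤ m :=
  (card_le_univ _).trans_eq (Fintype.card_fin m)

lemma passCount_mono (hs : 0 ≤ s) (ht : 0 ≤ t) : Monotone (passCount A s t p1 p2) := by
  intro r r' hr
  refine card_le_card (monotone_filter_right _ fun j _ hj => ?_)
  have hr' : (r : ℝ) ≤ r' := by exact_mod_cast hr
  exact ⟨hj.1.trans (by gcongr), hj.2.trans (by gcongr)⟩

lemma passCount_antitone (r : ℕ) : Antitone fun p2 => passCount A s t p1 p2 r := by
  intro x y hxy
  exact card_le_card (monotone_filter_right _ fun j _ hj => ⟨hj.1, (hxy j).trans hj.2⟩)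

lemma stepUpIndex_le : stepUpIndex A s t p1 p2 ≤ m := Nat.findGreatest_le m

lemma stepUpIndex_antitone : Antitone (stepUpIndex A s t p1) := fun _ _ hxy =>
  Nat.findGreatest_mono_left (fun r hr => hr.trans (passCount_antitone r hxy)) m

lemma passCount_stepUpIndex (hs : 0 ≤ s) (ht : 0 ≤ t) :
    passCount A s t p1 p2 (stepUpIndex A s t p1 p2) = stepUpIndex A s t p1 p2 := by
  have h : stepUpIndex A s t p1 p2 ≤ passCount A s t p1 p2 (stepUpIndex A s t p1 p2) :=
    Nat.findGreatest_spec (P := fun r => r ≤ passCount A s t p1 p2 r) (Nat.zero_le m)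
      (Nat.zero_le _)
  exact le_antisymm (Nat.le_findGreatest (passCount_le _) (passCount_mono hs ht h)) h

lemma sSup_fixedPoints_passCount (hs : 0 ≤ s) (ht : 0 ≤ t) :
    sSup {r : ℕ | r ≤ m ∧ passCount A s t p1 p2 r = r} = stepUpIndex A s t p1 p2 := by
  refine IsGreatest.csSup_eq ⟨⟨stepUpIndex_le, passCount_stepUpIndex hs ht⟩, ?_⟩
  rintro r ⟨hr, hN⟩
  exact Nat.le_findGreatest hr hN.ge

end StepUp

lemma rejSet_eq_filter {m : ℕ} (S : (Fin m → ℝ) → Finset (Fin m)) {a c : ℝ} (ha : 0 ≤ a)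
    (hc : 0 ≤ c) (p1 p2 : Fin m → ℝ) :
    rejSet m S a (fun _ => c) p1 p2 = (S p1).filter fun j =>
      p1 j ≤ stepUpIndex (S p1) (a / m) (c / (S p1).card) p1 p2 * (a / m) ∧
      p2 j ≤ stepUpIndex (S p1) (a / m) (c / (S p1).card) p1 p2 * (c / (S p1).card) := by
  rw [← sSup_fixedPoints_passCount (by positivity) (by positivity)]
  simp only [rejSet, passCount, mul_div_assoc]
  congr!

lemma card_rejSet {m : ℕ} (S : (Fin m → ℝ) → Finset (Fin m)) {a c : ℝ} (ha : 0 ≤ a)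
    (hc : 0 ≤ c) (p1 p2 : Fin m → ℝ) :
    (rejSet m S a (fun _ => c) p1 p2).card =
      stepUpIndex (S p1) (a / m) (c / (S p1).card) p1 p2 := by
  rw [rejSet_eq_filter S ha hc]
  exact passCount_stepUpIndex (by positivity) (by positivity)

lemma FDP_nonneg {m : ℕ} (I R : Finset (Fin m)) : 0 ≤ FDP I R := by
  unfold FDP; positivity

lemma FDP_eq_sum {m : ℕ} (I R : Finset (Fin m)) :
    FDP I R = ∑ j ∈ I, if j ∈ R then (R.card : ℝ)⁻¹ else 0 := by
  rw [← sum_filter, sum_const, nsmul_eq_mul, FDP, filter_mem_eq_inter, inter_comm, div_eq_mul_inv]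
  rcases R.eq_empty_or_nonempty with rfl | hR
  · simp
  · rw [max_eq_left hR.card_pos]

/-- The false discovery proportion splits into the contributions of the primary nulls and of the
follow-up nulls. -/
lemma FDP_rejSet_le {m : ℕ} (h1 h2 : Fin m → Bool) (S : (Fin m → ℝ) → Finset (Fin m)) {a c : ℝ}
    (ha : 0 ≤ a) (hc : 0 ≤ c) (p1 p2 : Fin m → ℝ) :
    FDP (nullNR h1 h2) (rejSet m S a (fun _ => c) p1 p2) ≤
      (∑ j with h1 j = false,
        if p1 j ≤ stepUpIndex (S p1) (a / m) (c / (S p1).card) p1 p2 * (a / m)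
        then (stepUpIndex (S p1) (a / m) (c / (S p1).card) p1 p2 : ℝ)⁻¹ else 0) +
      ∑ j with h2 j = false,
        if j ∈ S p1 ∧ p2 j ≤ stepUpIndex (S p1) (a / m) (c / (S p1).card) p1 p2 *
          (c / (S p1).card)
        then (stepUpIndex (S p1) (a / m) (c / (S p1).card) p1 p2 : ℝ)⁻¹ else 0 := by
  rw [FDP_eq_sum, card_rejSet S ha hc, nullNR, filter_or]
  set K := stepUpIndex (S p1) (a / m) (c / (S p1).card) p1 p2
  have hR : ∀ j ∈ rejSet m S a (fun _ => c) p1 p2,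
      j ∈ S p1 ∧ p1 j ≤ K * (a / m) ∧ p2 j ≤ K * (c / (S p1).card) := fun j hj => by
    rwa [rejSet_eq_filter S ha hc, mem_filter] at hj
  have hnn {p : Prop} [Decidable p] : 0 ≤ if p then (K : ℝ)⁻¹ else 0 := by
    split_ifs <;> positivity
  calc _ ≤ _ := le_add_of_nonneg_right (sum_nonneg fun _ _ => hnn)
    _ = _ := sum_union_inter
    _ ≤ _ := ?_
  refine add_le_add (sum_le_sum fun j _ => ?_) (sum_le_sum fun j _ => ?_)
  · split_ifs with h h'
    · rfl
    · exact absurd (hR j h).2.1 h'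
    · positivity
    · rfl
  · split_ifs with h h'
    · rfl
    · exact absurd ⟨(hR j h).1, (hR j h).2.2⟩ h'
    · positivity
    · rfl

/-- Telescoping bound `1/K = ∑_{k=K}^{n} 1/(k(k+1)) + 1/(n+1)`, with indicators. -/
lemma ite_inv_le_sum {x t : ℝ} (ht : 0 ≤ t) {K n : ℕ} (hK : K ≤ n + 1) :
    (if x ≤ K * t then (K : ℝ)⁻¹ else 0) ≤
      (∑ i ∈ range n, if x ≤ ((i : ℝ) + 1) * t then (1 : ℝ) / ((i + 1) * (i + 2)) else 0) +
        if x ≤ ((n : ℝ) + 1) * t then (1 : ℝ) / (n + 1) else 0 := by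
  have hnn (n : ℕ) : 0 ≤ ∑ i ∈ range n,
      if x ≤ ((i : ℝ) + 1) * t then (1 : ℝ) / ((i + 1) * (i + 2)) else 0 :=
    sum_nonneg fun i _ => by split_ifs <;> positivity
  split_ifs with h1 h2 h2
  · induction n with
    | zero =>
      interval_cases K <;> simp
    | succ n ih =>
      rcases hK.eq_or_lt with rfl | hK
      · have := hnn (n + 1)
        push_cast
        rw [one_div]
        linarith
      · have hK' : (K : ℝ) ≤ (n : ℝ) + 1 := by exact_mod_cast Nat.lt_succ_iff.mp hK
        have hx : x ≤ ((n : ℝ) + 1) * t := h1.trans (by gcongr)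
        have := ih (Nat.lt_succ_iff.mp hK) hx
        rw [sum_range_succ, if_pos hx]
        have e : (1 : ℝ) / ((n + 1) * (n + 2)) + 1 / (((n + 1 : ℕ) : ℝ) + 1) = 1 / (n + 1) := by
          push_cast; field_simp; ring
        linarith
  · exact absurd (h1.trans (by gcongr; exact_mod_cast hK)) h2
  · have := hnn n; positivity
  · simpa using hnn n

section Probability

variable {Ω : Type*} [MeasurableSpace Ω] {μ : Measure Ω}

lemma integral_ite_const {p : Ω → Prop} [DecidablePred p] (hp : MeasurableSet {ω | p ω})
    (y : ℝ) : ∫ ω, (if p ω then y else 0) ∂μ = μ.real {ω | p ω} * y := by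
  have : (fun ω => if p ω then y else 0) = Set.indicator {ω | p ω} fun _ => y := by
    ext ω; simp [Set.indicator_apply]
  rw [this, integral_indicator_const _ hp, smul_eq_mul]

variable [IsProbabilityMeasure μ]

lemma Superuniform.measureReal_le {m : ℕ} {P : Ω → Fin m → ℝ} {h : Fin m → Bool}
    (hsup : Superuniform μ P h) {j : Fin m} (hj : h j = false) {x : ℝ} (hx : 0 ≤ x) :
    μ.real {ω | P ω j ≤ x} ≤ x := by
  rcases le_total x 1 with h1 | h1
  · exact ENNReal.toReal_le_of_le_ofReal hx (hsup j hj x hx h1)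
  · exact measureReal_le_one.trans h1

lemma integrable_ite_const {p : Ω → Prop} [DecidablePred p] (hp : MeasurableSet {ω | p ω})
    (y : ℝ) : Integrable (fun ω => if p ω then y else 0) μ := by
  have : (fun ω => if p ω then y else 0) = Set.indicator {ω | p ω} fun _ => y := by
    ext ω; simp [Set.indicator_apply]
  rw [this]
  exact (integrable_const y).indicator hp

lemma integrable_ite_inv {p : Ω → Prop} [DecidablePred p] (hp : MeasurableSet {ω | p ω})
    {f : Ω → ℕ} (hf : Measurable f) : Integrable (fun ω => if p ω then (f ω : ℝ)⁻¹ else 0) μ := by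
  refine Integrable.of_mem_Icc 0 1 (Measurable.ite hp (measurable_from_top.comp hf).inv
    measurable_const).aemeasurable (ae_of_all _ fun ω => ?_)
  split_ifs
  · exact ⟨by positivity, Nat.cast_inv_le_one _⟩
  · simp

/-- Whatever the dependence between the p-value `X` and the rejection count, the expectation of
the dominating sum of `ite_inv_le_sum` is at most `t` times the harmonic sum. -/
lemma integral_sum_ite_le {X : Ω → ℝ} (hX : Measurable X) {t : ℝ} (ht : 0 ≤ t)
    (hsup : ∀ x, 0 ≤ x → μ.real {ω | X ω ≤ x} ≤ x) (n : ℕ) :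
    ∫ ω, ((∑ i ∈ range n,
        if X ω ≤ ((i : ℝ) + 1) * t then (1 : ℝ) / ((i + 1) * (i + 2)) else 0) +
        if X ω ≤ ((n : ℝ) + 1) * t then (1 : ℝ) / (n + 1) else 0) ∂μ ≤ t * Hsum (n + 1) := by
  have hm (x : ℝ) : MeasurableSet {ω | X ω ≤ x} := measurableSet_le hX measurable_const
  rw [integral_add (integrable_finsetSum _ fun i _ => integrable_ite_const (hm _) _)
    (integrable_ite_const (hm _) _),
    integral_finsetSum _ fun i _ => integrable_ite_const (hm _) _]
  simp_rw [integral_ite_const (hm _)]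
  rw [Hsum, sum_range_succ', mul_add, mul_sum]
  refine add_le_add (sum_le_sum fun i _ => ?_) ?_
  · calc _ ≤ ((i : ℝ) + 1) * t * (1 / ((i + 1) * (i + 2))) := by
          gcongr; exact hsup _ (by positivity)
      _ = _ := by push_cast; field_simp; ring
  · calc _ ≤ ((n : ℝ) + 1) * t * (1 / (n + 1)) := by
          gcongr; exact hsup _ (by positivity)
      _ = _ := by field_simp; simp

/-- Under PRDS, `x ↦ Pr(Q ∈ D | Q_i ≤ x)` is nondecreasing for increasing `D`
(in cross-multiplied form). -/
lemma PRDS.measureReal_mul_le {m : ℕ} {Q : Ω → Fin m → ℝ} {T : Set (Fin m)}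
    (hQ : PRDS μ Q T) (hQm : Measurable Q) (hQu : InUnit Q) {D : Set (Fin m → ℝ)}
    (hD : MeasurableSet D) (hDup : IsUpperSet D) {i : Fin m} (hi : i ∈ T) {s t : ℝ}
    (hst : s ≤ t) :
    μ.real ({ω | Q ω ∈ D} ∩ {ω | Q ω i ≤ s}) * μ.real {ω | Q ω i ≤ t} ≤
      μ.real ({ω | Q ω ∈ D} ∩ {ω | Q ω i ≤ t}) * μ.real {ω | Q ω i ≤ s} := by
  obtain ⟨g, hg, hgm, hgi⟩ := hQ D hD (fun x hx y hxy => hDup hxy hx) i hi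
  have hQi : Measurable fun ω => Q ω i := (measurable_pi_apply i).comp hQm
  have hint : Integrable (fun ω => g (Q ω i)) μ :=
    Integrable.of_mem_Icc (g 0) (g 1) (hgm.comp hQi).aemeasurable
      (ae_of_all _ fun ω => ⟨hg (hQu ω i).1, hg (hQu ω i).2⟩)
  have hmD : MeasurableSet {ω | Q ω ∈ D} := hQm hD
  have hms : MeasurableSet {ω | Q ω i ≤ s} := hQi measurableSet_Iic
  have hmst : MeasurableSet {ω | Q ω i ∈ Set.Ioc s t} := hQi measurableSet_Ioc
  have hdisj : Disjoint {ω | Q ω i ≤ s} {ω | Q ω i ∈ Set.Ioc s t} :=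
    Set.disjoint_left.2 fun ω h h' => h'.1.not_ge h
  have hunion : {ω | Q ω i ≤ t} = {ω | Q ω i ≤ s} ∪ {ω | Q ω i ∈ Set.Ioc s t} := by
    ext ω
    simp only [Set.mem_ofPred_eq, Set.mem_union, Set.mem_Ioc]
    constructor
    · intro h; rcases le_or_gt (Q ω i) s with h' | h'
      · exact .inl h'
      · exact .inr ⟨h', h⟩
    · rintro (h | h)
      · exact h.trans hst
      · exact h.2
  have hs : μ.real ({ω | Q ω ∈ D} ∩ {ω | Q ω i ≤ s}) ≤ g s * μ.real {ω | Q ω i ≤ s} := by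
    refine (hgi (Set.Iic s) measurableSet_Iic).trans_le ?_
    refine (setIntegral_mono_on hint.integrableOn (integrable_const (g s)).integrableOn hms
      fun ω hω => hg hω).trans_eq ?_
    simp [mul_comm]
  have hr : g s * μ.real {ω | Q ω i ∈ Set.Ioc s t} ≤
      μ.real ({ω | Q ω ∈ D} ∩ {ω | Q ω i ∈ Set.Ioc s t}) := by
    refine le_of_le_of_eq ?_ (hgi (Set.Ioc s t) measurableSet_Ioc).symm
    refine le_of_eq_of_le ?_ (setIntegral_mono_on (integrable_const (g s)).integrableOn
      hint.integrableOn hmst fun ω hω => hg hω.1.le)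
    simp [mul_comm]
  rw [hunion, Set.inter_union_distrib_left, measureReal_union hdisj hmst,
    measureReal_union (hdisj.mono Set.inter_subset_right Set.inter_subset_right)
      (hmD.inter hmst)]
  have h1 := mul_le_mul_of_nonneg_right hs
    (measureReal_nonneg (μ := μ) (s := {ω | Q ω i ∈ Set.Ioc s t}))
  have h2 := mul_le_mul_of_nonneg_right hr
    (measureReal_nonneg (μ := μ) (s := {ω | Q ω i ≤ s}))
  linarith

/-- Under PRDS, a null coordinate rejected by a step-up procedure with linear thresholds
`c, 2c, 3c, …` contributes at most `c` to the false discovery rate. -/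
lemma PRDS.integral_ite_inv_le {m : ℕ} {Q : Ω → Fin m → ℝ} {T : Set (Fin m)}
    (hQ : PRDS μ Q T) (hQm : Measurable Q) (hQu : InUnit Q) {i : Fin m} (hi : i ∈ T)
    (hsup : ∀ x, 0 ≤ x → μ.real {ω | Q ω i ≤ x} ≤ x) {f : (Fin m → ℝ) → ℕ}
    (hf : Antitone f) (hfm : Measurable f) {n : ℕ} (hfn : ∀ p, f p ≤ n) {c : ℝ} (hc : 0 ≤ c) :
    ∫ ω, (if Q ω i ≤ f (Q ω) * c then (f (Q ω) : ℝ)⁻¹ else 0) ∂μ ≤ c := by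
  have hQi : Measurable fun ω => Q ω i := (measurable_pi_apply i).comp hQm
  have hA (x : ℝ) : MeasurableSet {ω | Q ω i ≤ x} := hQi measurableSet_Iic
  have hE (k : ℕ) : MeasurableSet {ω | f (Q ω) = k} := (hfm.comp hQm) (measurableSet_singleton k)
  have hm (k : ℕ) : MeasurableSet {ω | f (Q ω) = k ∧ Q ω i ≤ k * c} := (hE k).inter (hA _)
  let F (k l : ℕ) : ℝ := μ.real ({ω | Q ω ∈ {p | f p ≤ l}} ∩ {ω | Q ω i ≤ k * c})
  let p (k : ℕ) : ℝ := μ.real {ω | Q ω i ≤ k * c}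
  have hFp (k l : ℕ) : F k l ≤ p k := measureReal_mono Set.inter_subset_right
  have hF0 (k l : ℕ) : 0 ≤ F k l := measureReal_nonneg
  have hp0 (k : ℕ) : 0 ≤ p k := measureReal_nonneg
  have hFm (k l : ℕ) : MeasurableSet ({ω | Q ω ∈ {p | f p ≤ l}} ∩ {ω | Q ω i ≤ k * c}) :=
    (hQm (hfm measurableSet_Iic)).inter (hA _)
  have hmono (k : ℕ) : F k k / p k ≤ F (k + 1) k / p (k + 1) := by
    rcases (hp0 k).eq_or_lt with h0 | h0
    · rw [← h0, div_zero]
      exact div_nonneg (hF0 _ _) measureReal_nonneg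
    have hst : (k : ℝ) * c ≤ ((k + 1 : ℕ) : ℝ) * c := by gcongr; simp
    have h1 : p k ≤ p (k + 1) := measureReal_mono fun ω hω => le_trans hω hst
    rw [div_le_div_iff₀ h0 (h0.trans_le h1)]
    exact hQ.measureReal_mul_le hQm hQu (hfm measurableSet_Iic)
      (fun x y hxy hx => (hf hxy).trans hx) hi hst
  have hdiff (k : ℕ) : μ.real {ω | f (Q ω) = k + 1 ∧ Q ω i ≤ (k + 1 : ℕ) * c} =
      F (k + 1) (k + 1) - F (k + 1) k := by
    rw [eq_sub_iff_add_eq]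
    refine (measureReal_union ?_ (hFm (k + 1) k)).symm.trans ?_
    rotate_left
    · congr 1
      ext ω
      simp only [Set.mem_union, Set.mem_ofPred_eq, Set.mem_inter_iff, Nat.le_succ_iff]
      tauto
    · refine Set.disjoint_left.2 fun ω h h' => ?_
      have h1 : f (Q ω) = k + 1 := h.1
      have h2 : f (Q ω) ≤ k := h'.1
      omega
  have hstep (k : ℕ) : μ.real {ω | f (Q ω) = k + 1 ∧ Q ω i ≤ (k + 1 : ℕ) * c} *
      ((k + 1 : ℕ) : ℝ)⁻¹ ≤ c * (F (k + 1) (k + 1) / p (k + 1) - F (k + 1) k / p (k + 1)) := by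
    rw [← sub_div, ← hdiff]
    set d := μ.real {ω | f (Q ω) = k + 1 ∧ Q ω i ≤ (k + 1 : ℕ) * c}
    have hd : d ≤ p (k + 1) := measureReal_mono fun ω hω => hω.2
    have hd0 : 0 ≤ d := measureReal_nonneg
    have hp : p (k + 1) ≤ (k + 1 : ℕ) * c := hsup _ (by positivity)
    rcases (hp0 (k + 1)).eq_or_lt with h0 | h0
    · have : d = 0 := le_antisymm (hd.trans_eq h0.symm) hd0
      simp [this]
    · rw [← div_eq_mul_inv, mul_div_assoc', div_le_div_iff₀ (by positivity) h0]
      nlinarith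
  have hsum (n : ℕ) : ∑ k ∈ range n, μ.real {ω | f (Q ω) = k + 1 ∧ Q ω i ≤ (k + 1 : ℕ) * c} *
      ((k + 1 : ℕ) : ℝ)⁻¹ ≤ c * (F n n / p n) := by
    induction n with
    | zero => simpa using mul_nonneg hc (div_nonneg (hF0 0 0) measureReal_nonneg)
    | succ n ih =>
      rw [sum_range_succ]
      have := mul_le_mul_of_nonneg_left (hmono n) hc
      linarith [hstep n]
  have hpt (ω : Ω) : (if Q ω i ≤ f (Q ω) * c then (f (Q ω) : ℝ)⁻¹ else 0) =
      ∑ k ∈ range n, if f (Q ω) = k + 1 ∧ Q ω i ≤ (k + 1 : ℕ) * c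
        then ((k + 1 : ℕ) : ℝ)⁻¹ else 0 := by
    have hfω := hfn (Q ω)
    generalize f (Q ω) = K at hfω
    cases K with
    | zero => simp
    | succ K =>
      rw [sum_eq_single_of_mem K (mem_range.2 hfω) fun k _ hk => if_neg fun h => by omega]
      simp
  simp_rw [hpt]
  rw [integral_finsetSum _ fun k _ => integrable_ite_const (hm (k + 1)) _]
  simp_rw [fun k : ℕ => integral_ite_const (μ := μ) (hm (k + 1)) (((k + 1 : ℕ) : ℝ)⁻¹)]
  refine (hsum n).trans (mul_le_of_le_one_right hc ?_)
  exact div_le_one_of_le₀ (hFp n n) measureReal_nonneg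

end Probability

lemma MeasRule.measurableSet_mem {m : ℕ} {S : (Fin m → ℝ) → Finset (Fin m)} (hS : MeasRule m S)
    (j : Fin m) : MeasurableSet {p | j ∈ S p} := by
  have : {p | j ∈ S p} = ⋃ A ∈ {A : Finset (Fin m) | j ∈ A}, {p | S p = A} := by ext; simp
  rw [this]
  exact MeasurableSet.biUnion (Set.to_countable _) fun A _ => hS A

lemma MeasRule.measurable_card {m : ℕ} {S : (Fin m → ℝ) → Finset (Fin m)} (hS : MeasRule m S) :
    Measurable fun p => ((S p).card : ℝ) := by
  have : (fun p => ((S p).card : ℝ)) = fun p => ∑ j, if j ∈ S p then (1 : ℝ) else 0 := by ext; simp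
  rw [this]
  exact Finset.measurable_fun_sum _ fun j _ =>
    Measurable.ite (hS.measurableSet_mem j) measurable_const measurable_const

lemma MeasRule.measurable_stepUpIndex {m : ℕ} {S : (Fin m → ℝ) → Finset (Fin m)}
    (hS : MeasRule m S) (s c : ℝ) :
    Measurable fun p : (Fin m → ℝ) × (Fin m → ℝ) =>
      stepUpIndex (S p.1) s (c / (S p.1).card) p.1 p.2 := by
  have hcard : Measurable fun p : (Fin m → ℝ) × (Fin m → ℝ) => ((S p.1).card : ℝ) :=
    hS.measurable_card.comp measurable_fst
  have hN (r : ℕ) : Measurable fun p : (Fin m → ℝ) × (Fin m → ℝ) =>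
      passCount (S p.1) s (c / (S p.1).card) p.1 p.2 r := by
    have : (fun p : (Fin m → ℝ) × (Fin m → ℝ) =>
        passCount (S p.1) s (c / (S p.1).card) p.1 p.2 r) = fun p => ∑ j,
        if j ∈ S p.1 ∧ p.1 j ≤ r * s ∧ p.2 j ≤ r * (c / (S p.1).card) then 1 else 0 := by
      ext p
      rw [passCount, ← card_filter]
      congr 1
      ext j
      simp
    rw [this]
    refine Finset.measurable_fun_sum _ fun j _ =>
      Measurable.ite ?_ measurable_const measurable_const
    have h1 : Measurable fun p : (Fin m → ℝ) × (Fin m → ℝ) => p.1 j := by fun_prop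
    have h2 : Measurable fun p : (Fin m → ℝ) × (Fin m → ℝ) => p.2 j := by fun_prop
    exact (measurable_fst (hS.measurableSet_mem j)).inter
      ((measurableSet_le h1 measurable_const).inter
        (measurableSet_le h2 ((hcard.const_div c).const_mul (r : ℝ))))
  exact measurable_findGreatest fun k _ => measurableSet_le measurable_const (hN k)

/-- The contribution of the indices in `I` to the false discovery proportion, when only their
follow-up p-values are compared with the thresholds. -/
noncomputable def followUpPart {m : ℕ} (I A : Finset (Fin m)) (s c : ℝ) (p1 p2 : Fin m → ℝ) :
    ℝ :=
  ∑ j ∈ I, if j ∈ A ∧ p2 j ≤ stepUpIndex A s (c / A.card) p1 p2 * (c / A.card)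
    then (stepUpIndex A s (c / A.card) p1 p2 : ℝ)⁻¹ else 0

lemma MeasRule.integrable_followUpPart {m : ℕ} {S : (Fin m → ℝ) → Finset (Fin m)}
    (hS : MeasRule m S) (I : Finset (Fin m)) (s c : ℝ)
    (ν : Measure ((Fin m → ℝ) × (Fin m → ℝ))) [IsProbabilityMeasure ν] :
    Integrable (fun p => followUpPart I (S p.1) s c p.1 p.2) ν := by
  have hcard : Measurable fun p : (Fin m → ℝ) × (Fin m → ℝ) => ((S p.1).card : ℝ) :=
    hS.measurable_card.comp measurable_fst
  have hK := hS.measurable_stepUpIndex s c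
  refine integrable_finsetSum _ fun j _ => integrable_ite_inv ?_ hK
  have h2 : Measurable fun p : (Fin m → ℝ) × (Fin m → ℝ) => p.2 j := by fun_prop
  exact (measurable_fst (hS.measurableSet_mem j)).inter
    (measurableSet_le h2 ((measurable_from_top.comp hK).mul (hcard.const_div c)))

/-- Conditionally on the primary study, the follow-up nulls contribute at most `c` to the false
discovery rate. -/
lemma integral_followUpPart_le {Ω : Type*} [MeasurableSpace Ω] {μ : Measure Ω}
    [IsProbabilityMeasure μ] {m : ℕ} {Q : Ω → Fin m → ℝ} (hQm : Measurable Q) (hQu : InUnit Q)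
    {h : Fin m → Bool} (hsup : Superuniform μ Q h) (hQ : PRDS μ Q {j | h j = false})
    {S : (Fin m → ℝ) → Finset (Fin m)} (hS : MeasRule m S) (s : ℝ) {c : ℝ} (hc : 0 ≤ c)
    (p1 : Fin m → ℝ) :
    ∫ ω, followUpPart {j | h j = false} (S p1) s c p1 (Q ω) ∂μ ≤ c := by
  set A := S p1
  have hf : Measurable (stepUpIndex A s (c / A.card) p1) :=
    (hS.measurable_stepUpIndex s c).comp measurable_prodMk_left
  have hfQ : Measurable fun ω => stepUpIndex A s (c / A.card) p1 (Q ω) := hf.comp hQm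
  have hQj (j : Fin m) : Measurable fun ω => Q ω j := (measurable_pi_apply j).comp hQm
  have hm (j : Fin m) : MeasurableSet {ω | j ∈ A ∧
      Q ω j ≤ stepUpIndex A s (c / A.card) p1 (Q ω) * (c / A.card)} :=
    (MeasurableSet.const (j ∈ A)).inter
      (measurableSet_le (hQj j) ((measurable_from_top.comp hfQ).mul_const _))
  unfold followUpPart
  rw [integral_finsetSum _ fun j _ => integrable_ite_inv (hm j) hfQ]
  calc _ ≤ ∑ j with h j = false, if j ∈ A then c / A.card else 0 := by
        refine sum_le_sum fun j hj => ?_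
        have hj' : h j = false := (mem_filter.1 hj).2
        by_cases hA : j ∈ A
        · simp only [hA, true_and, if_true]
          exact hQ.integral_ite_inv_le hQm hQu hj' (fun x hx => hsup.measureReal_le hj' hx)
            stepUpIndex_antitone hf (fun _ => stepUpIndex_le) (by positivity)
        · simp [hA]
    _ ≤ ∑ j, if j ∈ A then c / A.card else 0 :=
        sum_le_sum_of_subset_of_nonneg (subset_univ _) fun j _ _ => by
          split_ifs <;> positivity
    _ = A.card * (c / A.card) := by simp
    _ ≤ c := by
        rw [mul_div_left_comm]
        exact mul_le_of_le_one_right hc (div_self_le_one _)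

/-- Theorem 3.3, item 1: with arbitrary dependence within the primary study,
PRDS follow-up p-values independent of the primary study, and a valid selection rule,
Procedure 3.2 with the primary thresholds computed from `q̃₁ = q₁ / (∑_{i=1}^m 1/i)` (follow-up
thresholds unchanged) controls the FDR at level `q` for the no-replicability nulls. -/
theorem procedure32_modified_FDR_control_arbitrary_primary {Ω : Type*} [MeasurableSpace Ω]
    (μ : Measure Ω) [IsProbabilityMeasure μ]
    (m : ℕ) (hm : 1 ≤ m)
    (P1 P2 : Ω → Fin m → ℝ) (hP1 : Measurable P1) (hP2 : Measurable P2)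
    (hP1u : InUnit P1) (hP2u : InUnit P2)
    (h1 h2 : Fin m → Bool)
    (hsup1 : Superuniform μ P1 h1) (hsup2 : Superuniform μ P2 h2)
    (hIndep : IndepFun P1 P2 μ)
    (hPRDS : PRDS μ P2 {j | h2 j = false})
    (S : (Fin m → ℝ) → Finset (Fin m)) (hS : MeasRule m S) (hval : ValidRule m S)
    (q1 q : ℝ) (hq1 : 0 < q1) (hq1q : q1 < q) (hq : q < 1) :
    ∫ ω, FDP (nullNR h1 h2)
        (rejSet m S (q1 / Hsum m) (fun _ => q - q1) (P1 ω) (P2 ω)) ∂μ ≤ q := by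
  obtain ⟨n, rfl⟩ : ∃ n, m = n + 1 := ⟨m - 1, by omega⟩
  have hH : 0 < Hsum (n + 1) := sum_pos (fun i _ => by positivity) ⟨0, by simp⟩
  set a := q1 / Hsum (n + 1) with ha_def
  have ha : 0 ≤ a := by positivity
  have hc : 0 ≤ q - q1 := by linarith
  set t := a / (n + 1 : ℕ) with ht_def
  have ht : 0 ≤ t := by positivity
  have hP1j (j : Fin (n + 1)) : Measurable fun ω => P1 ω j := (measurable_pi_apply j).comp hP1
  let W (x : ℝ) : ℝ :=
    (∑ i ∈ range n, if x ≤ ((i : ℝ) + 1) * t then (1 : ℝ) / ((i + 1) * (i + 2)) else 0) +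
      if x ≤ ((n : ℝ) + 1) * t then (1 : ℝ) / (n + 1) else 0
  have hm (j : Fin (n + 1)) (x : ℝ) : MeasurableSet {ω | P1 ω j ≤ x} := hP1j j measurableSet_Iic
  have hWint (j : Fin (n + 1)) : Integrable (fun ω => W (P1 ω j)) μ :=
    (integrable_finsetSum _ fun i _ => integrable_ite_const (hm j _) _).add
      (integrable_ite_const (hm j _) _)
  have : IsProbabilityMeasure (μ.map P1) := Measure.isProbabilityMeasure_map hP1.aemeasurable
  have : IsProbabilityMeasure (μ.map P2) := Measure.isProbabilityMeasure_map hP2.aemeasurable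
  have hBν := hS.integrable_followUpPart {j | h2 j = false} t (q - q1)
    ((μ.map P1).prod (μ.map P2))
  have hprod := (indepFun_iff_map_prod_eq_prod_map_map hP1.aemeasurable hP2.aemeasurable).1 hIndep
  have hP : AEMeasurable (fun ω => (P1 ω, P2 ω)) μ := (hP1.prodMk hP2).aemeasurable
  have hBint : Integrable
      (fun ω => followUpPart {j | h2 j = false} (S (P1 ω)) t (q - q1) (P1 ω) (P2 ω)) μ := by
    rw [← hprod] at hBν
    exact hBν.comp_aemeasurable hP
  have hprimary : ∫ ω, ∑ j with h1 j = false, W (P1 ω j) ∂μ ≤ q1 := by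
    rw [integral_finsetSum _ fun j _ => hWint j]
    calc _ ≤ ∑ j with h1 j = false, t * Hsum (n + 1) := sum_le_sum fun j hj =>
          integral_sum_ite_le (hP1j j) ht
            (fun x hx => hsup1.measureReal_le (mem_filter.1 hj).2 hx) n
      _ ≤ ∑ j : Fin (n + 1), t * Hsum (n + 1) :=
          sum_le_sum_of_subset_of_nonneg (subset_univ _) fun _ _ _ => by positivity
      _ = q1 := by
          rw [sum_const, card_univ, Fintype.card_fin, nsmul_eq_mul, ht_def, ha_def]
          field_simp
  have hfollowUp :
      ∫ ω, followUpPart {j | h2 j = false} (S (P1 ω)) t (q - q1) (P1 ω) (P2 ω) ∂μ ≤ q - q1 := by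
    have hBmap := hBν.aestronglyMeasurable
    rw [← hprod] at hBmap
    rw [← integral_map hP hBmap, hprod, integral_prod _ hBν]
    refine (integral_mono_ae (g := fun _ => q - q1) hBν.integral_prod_left (integrable_const _)
      ?_).trans_eq (by simp)
    filter_upwards [hBν.prod_right_ae] with p1 hp1
    rw [integral_map hP2.aemeasurable hp1.aestronglyMeasurable]
    exact integral_followUpPart_le hP2 hP2u hsup2 hPRDS hS t hc p1
  calc _ ≤ ∫ ω, ((∑ j with h1 j = false, W (P1 ω j)) +
        followUpPart {j | h2 j = false} (S (P1 ω)) t (q - q1) (P1 ω) (P2 ω)) ∂μ := by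
        refine integral_mono_of_nonneg (ae_of_all _ fun ω => FDP_nonneg _ _)
          ((integrable_finsetSum _ fun j _ => hWint j).add hBint) (ae_of_all _ fun ω => ?_)
        refine (FDP_rejSet_le h1 h2 S ha hc (P1 ω) (P2 ω)).trans ?_
        exact add_le_add (sum_le_sum fun j _ => ite_inv_le_sum ht stepUpIndex_le) le_rfl
    _ ≤ q1 + (q - q1) := by
        rw [integral_add (integrable_finsetSum _ fun j _ => hWint j) hBint]
        exact add_le_add hprimary hfollowUp
    _ = q := by ring

end Replicability
end

section
/- (Key inequality in the proof of Theorem 4.1) Let 𝓡_A and 𝓡_B be any two random subsets of {1,…,m} on a common probability space, and let I* ⊆ {1,…,m} be a fixed set. Then E[|(𝓡_A ∪ 𝓡_B) ∩ I*| / max(|𝓡_A ∪ 𝓡_B|, 1)] ≤ E[|𝓡_A ∩ I*| / max(|𝓡_A|, 1)] + E[|𝓡_B ∩ I*| / max(|𝓡_B|, 1)]; in particular, the false discovery rate of the procedure rejecting the union of two rejection sets is at most the sum of the false discovery rates of the two individual procedures. -/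
open MeasureTheory ProbabilityTheory Finset

namespace Replicability

/-- The false discovery proportion is subadditive under unions of rejection sets. -/
lemma FDP_union_le {m : ℕ} (I A B : Finset (Fin m)) :
    FDP I (A ∪ B) ≤ FDP I A + FDP I B := by
  unfold FDP
  have hcard : (((A ∪ B) ∩ I).card : ℝ) ≤ (A ∩ I).card + (B ∩ I).card := by
    rw [union_inter_distrib_right]
    exact_mod_cast card_union_le _ _
  have hpos (R : Finset (Fin m)) : (0 : ℝ) < ((max R.card 1 : ℕ) : ℝ) := by
    exact_mod_cast lt_max_of_lt_right one_pos
  have hA : ((max A.card 1 : ℕ) : ℝ) ≤ ((max (A ∪ B).card 1 : ℕ) : ℝ) := by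
    exact_mod_cast max_le_max_right 1 (card_le_card subset_union_left)
  have hB : ((max B.card 1 : ℕ) : ℝ) ≤ ((max (A ∪ B).card 1 : ℕ) : ℝ) := by
    exact_mod_cast max_le_max_right 1 (card_le_card subset_union_right)
  calc
    _ ≤ ((A ∩ I).card + (B ∩ I).card : ℝ) / ((max (A ∪ B).card 1 : ℕ) : ℝ) :=
      div_le_div_of_nonneg_right hcard (hpos _).le
    _ = (A ∩ I).card / ((max (A ∪ B).card 1 : ℕ) : ℝ)
        + (B ∩ I).card / ((max (A ∪ B).card 1 : ℕ) : ℝ) := add_div _ _ _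
    _ ≤ _ := add_le_add
      (div_le_div_of_nonneg_left (Nat.cast_nonneg _) (hpos A) hA)
      (div_le_div_of_nonneg_left (Nat.cast_nonneg _) (hpos B) hB)

/-- A real function of a random variable with finitely many values and measurable fibres is
integrable under a finite measure. -/
lemma integrable_comp_of_measurableSet_fiber {Ω α : Type*} [MeasurableSpace Ω] [Finite α]
    (μ : Measure Ω) [IsFiniteMeasure μ] {X : Ω → α}
    (hX : ∀ a, MeasurableSet {ω | X ω = a}) (f : α → ℝ) :
    Integrable (fun ω => f (X ω)) μ := by
  let _ : MeasurableSpace α := ⊤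
  have hmeas : Measurable X := measurable_to_countable' hX
  exact (Integrable.of_finite (f := f) (μ := μ.map X)).comp_measurable hmeas

/-- key inequality in the proof of Theorem 4.1: for any two random subsets
`𝓡_A, 𝓡_B` of `{1,…,m}` and any fixed `I* ⊆ {1,…,m}`, the FDR of the union is at most the sum
of the FDRs. -/
theorem FDR_union_le_sum {Ω : Type*} [MeasurableSpace Ω]
    (μ : Measure Ω) [IsProbabilityMeasure μ]
    (m : ℕ) (hm : 1 ≤ m)
    (RA RB : Ω → Finset (Fin m))
    (hRA : ∀ A : Finset (Fin m), MeasurableSet {ω | RA ω = A})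
    (hRB : ∀ A : Finset (Fin m), MeasurableSet {ω | RB ω = A})
    (Istar : Finset (Fin m)) :
    ∫ ω, FDP Istar (RA ω ∪ RB ω) ∂μ
      ≤ (∫ ω, FDP Istar (RA ω) ∂μ) + ∫ ω, FDP Istar (RB ω) ∂μ := by
  have hA := integrable_comp_of_measurableSet_fiber μ hRA (FDP Istar)
  have hB := integrable_comp_of_measurableSet_fiber μ hRB (FDP Istar)
  have hAB : Integrable (fun ω => FDP Istar (RA ω ∪ RB ω)) μ :=
    integrable_comp_of_measurableSet_fiber μ (X := fun ω => (RA ω, RB ω))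
      (fun p => by simpa [Prod.ext_iff, Set.ofPred_and] using (hRA p.1).inter (hRB p.2))
      (fun p => FDP Istar (p.1 ∪ p.2))
  rw [← integral_add hA hB]
  exact integral_mono hAB (hA.add hB) fun ω => FDP_union_le Istar (RA ω) (RB ω)

end Replicability
end
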